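/- If G is a finite simple graph that is a cycle, a path, or a 3-regular graph, then for every win condition w ∈ [1/2,1) and every initial configuration C_0 on G, the w-power index process is eventually stable. -/

import Mathlib

open scoped Classical

/-- A strategy of a voter: collaborator (`C`) or defector (`D`). -/
inductive Strategy : Type
  | C : Strategy
  | D : Strategy
deriving DecidableEq

noncomputable section

variable {V : Type*}

/-- The closed neighbourhood `N[v]` of a vertex, as a finset. -/
def closedNbhd (G : SimpleGraph V) [Fintype V] (v : V) : Finset V :=
  Finset.univ.filter fun u => u = v ∨ G.Adj u v

/-- The (Shapley–Shubik style) power of a vertex `v` in configuration `c`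
with win condition `w`. -/
def power (G : SimpleGraph V) [Fintype V] (w : ℝ) (c : V → Strategy) (v : V) : ℝ :=
  let N := closedNbhd G v
  let nC := (N.filter fun u => c u = Strategy.C).card
  let nD := (N.filter fun u => c u = Strategy.D).card
  match c v with
  | Strategy.C => if w < (nC : ℝ) / (N.card : ℝ) then 1 / (nC : ℝ) else 0
  | Strategy.D => if (nC : ℝ) / (N.card : ℝ) ≤ w then 1 / (nD : ℝ) else 0

/-- One step of the `w`-power index process: every vertex adopts the strategy of a
vertex of maximum power in its closed neighbourhood, retaining its own strategy if
vertices of maximum power have differing strategies. -/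
def step (G : SimpleGraph V) [Fintype V] (w : ℝ) (c : V → Strategy) (v : V) : Strategy :=
  let N := closedNbhd G v
  let M := N.filter fun u => ∀ x ∈ N, power G w c x ≤ power G w c u
  if ∀ u ∈ M, c u = Strategy.C then Strategy.C
  else if ∀ u ∈ M, c u = Strategy.D then Strategy.D
  else c v

/-- `configSeq G w c0 i` is the configuration `C_i` of the `w`-power index process. -/
def configSeq (G : SimpleGraph V) [Fintype V] (w : ℝ) (c0 : V → Strategy) : ℕ → V → Strategy
  | 0 => c0
  | k + 1 => step G w (configSeq G w c0 k)

/-- The process is eventually stable. -/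
def EventuallyStable (G : SimpleGraph V) [Fintype V] (w : ℝ) (c0 : V → Strategy) : Prop :=
  ∃ i, configSeq G w c0 (i + 1) = configSeq G w c0 i

/-- The process reaches a stable all-collaborator configuration. -/
def CollaboratorDominant (G : SimpleGraph V) [Fintype V] (w : ℝ) (c0 : V → Strategy) : Prop :=
  ∃ i, configSeq G w c0 (i + 1) = configSeq G w c0 i ∧
    ∀ v, configSeq G w c0 i v = Strategy.C

/-- The process reaches a stable all-defector configuration. -/
def DefectorDominant (G : SimpleGraph V) [Fintype V] (w : ℝ) (c0 : V → Strategy) : Prop :=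
  ∃ i, configSeq G w c0 (i + 1) = configSeq G w c0 i ∧
    ∀ v, configSeq G w c0 i v = Strategy.D

/-- The process is eventually periodic with period `ℓ`: `ℓ > 1` is the least integer
such that `C_i = C_{i+ℓ}` for some `i ≥ 0`. -/
def EventuallyPeriodicWithPeriod (G : SimpleGraph V) [Fintype V] (w : ℝ)
    (c0 : V → Strategy) (ℓ : ℕ) : Prop :=
  IsLeast {m : ℕ | 1 < m ∧ ∃ i, configSeq G w c0 (i + m) = configSeq G w c0 i} ℓ

end


section helpers
variable {V : Type} [Fintype V]

lemma mem_closedNbhd (G : SimpleGraph V) (u v : V) :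
    u ∈ closedNbhd G v ↔ u = v ∨ G.Adj u v := by
  simp [closedNbhd]

lemma self_mem (G : SimpleGraph V) (v : V) : v ∈ closedNbhd G v := by
  simp [closedNbhd]

/-- Number of collaborators in the closed neighbourhood. -/
noncomputable def nC (G : SimpleGraph V) (c : V → Strategy) (v : V) : ℕ :=
  ((closedNbhd G v).filter fun u => c u = Strategy.C).card

/-- Number of defectors in the closed neighbourhood. -/
noncomputable def nD (G : SimpleGraph V) (c : V → Strategy) (v : V) : ℕ :=
  ((closedNbhd G v).filter fun u => c u = Strategy.D).card

lemma ne_C_iff (s : Strategy) : s ≠ Strategy.C ↔ s = Strategy.D := by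
  cases s <;> simp

lemma nC_add_nD (G : SimpleGraph V) (c : V → Strategy) (v : V) :
    nC G c v + nD G c v = (closedNbhd G v).card := by
  have h := Finset.card_filter_add_card_filter_not (s := closedNbhd G v)
    (fun u => c u = Strategy.C)
  unfold nC nD
  rw [← h]
  congr 2
  ext u
  simp [← ne_C_iff]

lemma power_C (G : SimpleGraph V) (w : ℝ) (c : V → Strategy) (v : V) (h : c v = Strategy.C) :
    power G w c v = if w < (nC G c v : ℝ) / ((closedNbhd G v).card : ℝ)
      then 1 / (nC G c v : ℝ) else 0 := by
  simp [power, nC, h]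

lemma power_D (G : SimpleGraph V) (w : ℝ) (c : V → Strategy) (v : V) (h : c v = Strategy.D) :
    power G w c v = if (nC G c v : ℝ) / ((closedNbhd G v).card : ℝ) ≤ w
      then 1 / (nD G c v : ℝ) else 0 := by
  simp [power, nC, nD, h]

lemma power_nonneg (G : SimpleGraph V) (w : ℝ) (c : V → Strategy) (v : V) :
    0 ≤ power G w c v := by
  cases h : c v
  · rw [power_C G w c v h]; split_ifs <;> positivity
  · rw [power_D G w c v h]; split_ifs <;> positivity

lemma step_ne (G : SimpleGraph V) (w : ℝ) (c : V → Strategy) (v : V)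
    (h : step G w c v ≠ c v) :
    ∃ u ∈ closedNbhd G v, c u = step G w c v ∧ power G w c v < power G w c u := by
  obtain ⟨u, hu, hmax⟩ := Finset.exists_max_image (closedNbhd G v) (power G w c)
    ⟨v, self_mem G v⟩
  have key : ∀ s : Strategy, s ≠ c v →
      (∀ x ∈ (closedNbhd G v).filter
        (fun u => ∀ x ∈ closedNbhd G v, power G w c x ≤ power G w c u), c x = s) →
      c u = s ∧ power G w c v < power G w c u := by
    intro s hs hall
    refine ⟨hall u (by simpa using ⟨hu, hmax⟩), ?_⟩
    by_contra hlt
    push Not at hlt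
    exact hs (hall v (by
      simp only [Finset.mem_filter]
      exact ⟨self_mem G v, fun x hx => (hmax x hx).trans hlt⟩)).symm
  refine ⟨u, hu, ?_⟩
  generalize hs : step G w c v = s at h ⊢
  apply key s h
  simp only [step] at hs
  split_ifs at hs with h1 h2
  · subst hs; exact h1
  · subst hs; exact h2
  · exact absurd hs.symm h

lemma nD_pos (G : SimpleGraph V) (c : V → Strategy) (u v : V) (hu : u ∈ closedNbhd G v)
    (h : c u = Strategy.D) : 0 < nD G c v :=
  Finset.card_pos.2 ⟨u, by simp [hu, h]⟩

lemma nC_pos (G : SimpleGraph V) (c : V → Strategy) (u v : V) (hu : u ∈ closedNbhd G v)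
    (h : c u = Strategy.C) : 0 < nC G c v :=
  Finset.card_pos.2 ⟨u, by simp [hu, h]⟩

/-- Winning defectors. -/
def WinD (G : SimpleGraph V) (w : ℝ) (c : V → Strategy) (v : V) : Prop :=
  c v = Strategy.D ∧ (nC G c v : ℝ) ≤ w * ((closedNbhd G v).card : ℝ)

lemma card_pos' (G : SimpleGraph V) (v : V) : (0 : ℝ) < ((closedNbhd G v).card : ℝ) := by
  exact_mod_cast Finset.card_pos.2 ⟨v, self_mem G v⟩

lemma winD_of_power (G : SimpleGraph V) (w : ℝ) (c : V → Strategy) (v : V)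
    (h : c v = Strategy.D) (hp : 0 < power G w c v) : WinD G w c v := by
  rw [power_D G w c v h] at hp
  split_ifs at hp with h1
  · exact ⟨h, (div_le_iff₀ (card_pos' G v)).1 h1⟩
  · exact absurd hp (lt_irrefl _)

lemma symm_mem {G : SimpleGraph V} {u v : V} (h : u ∈ closedNbhd G v) : v ∈ closedNbhd G u := by
  rw [mem_closedNbhd] at *
  rcases h with h | h
  · exact Or.inl h.symm
  · exact Or.inr h.symm

lemma winD_of_two (G : SimpleGraph V) (w : ℝ) (hw : 1 / 2 ≤ w) (c : V → Strategy) (u v : V)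
    (h4 : (closedNbhd G v).card ≤ 4)
    (huv : u ≠ v) (hu : u ∈ closedNbhd G v) (h : c v = Strategy.D) (h' : c u = Strategy.D) :
    WinD G w c v := by
  refine ⟨h, ?_⟩
  have h2 : 2 ≤ nD G c v := by
    have : ({u, v} : Finset V).card = 2 := Finset.card_pair huv
    rw [← this]
    apply Finset.card_le_card
    intro x hx
    simp only [Finset.mem_insert, Finset.mem_singleton] at hx
    rcases hx with rfl | rfl
    · simp [hu, h']
    · simp [self_mem, h]
  have h3 := nC_add_nD G c v
  have h5 : 2 * nC G c v ≤ (closedNbhd G v).card := by omega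
  have h6 : (2 : ℝ) * nC G c v ≤ ((closedNbhd G v).card : ℝ) := by exact_mod_cast h5
  nlinarith [card_pos' G v]

lemma winD_stays (G : SimpleGraph V) (w : ℝ) (hw : 1 / 2 ≤ w) (c : V → Strategy) (v : V)
    (h4 : ∀ v, (closedNbhd G v).card ≤ 4)
    (hreg : ∀ u v, 3 ≤ (closedNbhd G u).card →
      (closedNbhd G v).card ≤ (closedNbhd G u).card)
    (h : WinD G w c v) : step G w c v = Strategy.D := by
  by_contra hne
  have hD := h.1
  obtain ⟨u, hu, hcu, hlt⟩ := step_ne G w c v (by rw [hD]; exact hne)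
  have hC : c u = Strategy.C := by
    rw [hcu]; cases hs : step G w c v
    · rfl
    · exact absurd hs hne
  rw [power_D G w c v hD, if_pos ((div_le_iff₀ (card_pos' G v)).2 h.2),
    power_C G w c u hC] at hlt
  have dv := nD_pos G c v v (self_mem G v) hD
  have cv := nC_pos G c u v hu hC
  have du := nD_pos G c v u (symm_mem hu) hD
  have cu := nC_pos G c u u (self_mem G u) hC
  have sv := nC_add_nD G c v
  have su := nC_add_nD G c u
  split_ifs at hlt with hw'
  · rw [lt_div_iff₀ (card_pos' G u)] at hw'
    have h2 : ((closedNbhd G u).card : ℝ) < 2 * nC G c u := by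
      nlinarith [card_pos' G u]
    have h2' : (closedNbhd G u).card < 2 * nC G c u := by exact_mod_cast h2
    have h3 := h4 u
    have h5 := hreg u v (by omega)
    have h6 : nD G c v ≤ nC G c u := by omega
    have h7 : (1 : ℝ) / nC G c u ≤ 1 / nD G c v := by
      apply one_div_le_one_div_of_le
      · exact_mod_cast dv
      · exact_mod_cast h6
    linarith
  · have : (0 : ℝ) ≤ 1 / nD G c v := by positivity
    linarith

lemma winD_persists (G : SimpleGraph V) (w : ℝ) (hw : 1 / 2 ≤ w) (c : V → Strategy) (v : V)
    (h4 : ∀ v, (closedNbhd G v).card ≤ 4)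
    (hreg : ∀ u v, 3 ≤ (closedNbhd G u).card →
      (closedNbhd G v).card ≤ (closedNbhd G u).card)
    (h : WinD G w c v) : WinD G w (step G w c) v := by
  have hs := winD_stays G w hw c v h4 hreg h
  by_cases hex : ∃ u, u ≠ v ∧ u ∈ closedNbhd G v ∧ c u = Strategy.D
  · obtain ⟨u, huv, hu, hcu⟩ := hex
    have hwu := winD_of_two G w hw c v u (h4 u) huv.symm (symm_mem hu) hcu h.1
    exact winD_of_two G w hw _ u v (h4 v) huv hu hs (winD_stays G w hw c u h4 hreg hwu)
  · refine ⟨hs, le_trans ?_ h.2⟩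
    have h1 : nD G c v ≤ 1 := by
      refine Finset.card_le_one.2 ?_
      intro a ha b hb
      simp only [Finset.mem_filter] at ha hb
      have h1 : a = v := by
        by_contra hh; exact hex ⟨a, hh, ha.1, ha.2⟩
      have h2 : b = v := by
        by_contra hh; exact hex ⟨b, hh, hb.1, hb.2⟩
      rw [h1, h2]
    have h2 := nD_pos G (step G w c) v v (self_mem G v) hs
    have h3 := nC_add_nD G c v
    have h5 := nC_add_nD G (step G w c) v
    have : nC G (step G w c) v ≤ nC G c v := by omega
    exact_mod_cast this

/-- The potential. -/
noncomputable def pot (G : SimpleGraph V) (w : ℝ) (c : V → Strategy) : ℕ :=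
  (Finset.univ.filter fun v => WinD G w c v).card * (Fintype.card V + 1) +
    (Finset.univ.filter fun v => c v = Strategy.C).card

lemma pot_le (G : SimpleGraph V) (w : ℝ) (c : V → Strategy) :
    pot G w c ≤ Fintype.card V * (Fintype.card V + 1) + Fintype.card V := by
  unfold pot
  gcongr <;> exact Finset.card_le_univ _

lemma pot_lt (G : SimpleGraph V) (w : ℝ) (hw : 1 / 2 ≤ w) (c : V → Strategy)
    (h4 : ∀ v, (closedNbhd G v).card ≤ 4)
    (hreg : ∀ u v, 3 ≤ (closedNbhd G u).card →
      (closedNbhd G v).card ≤ (closedNbhd G u).card)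
    (hne : step G w c ≠ c) : pot G w c < pot G w (step G w c) := by
  have hsub : (Finset.univ.filter fun v => WinD G w c v) ⊆
      (Finset.univ.filter fun v => WinD G w (step G w c) v) := by
    intro v hv
    simp only [Finset.mem_filter, Finset.mem_univ, true_and] at *
    exact winD_persists G w hw c v h4 hreg hv
  by_cases hflip : ∃ v, c v = Strategy.C ∧ step G w c v = Strategy.D
  · obtain ⟨v, hc, hs⟩ := hflip
    obtain ⟨u, hu, hcu, hlt⟩ := step_ne G w c v (by rw [hc, hs]; simp)
    rw [hs] at hcu
    have huw := winD_of_power G w c u hcu (lt_of_le_of_lt (power_nonneg G w c v) hlt)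
    have huv : u ≠ v := by
      rintro rfl; rw [hc] at hcu; cases hcu
    have hv := winD_of_two G w hw (step G w c) u v (h4 v) huv hu hs
      (winD_stays G w hw c u h4 hreg huw)
    have hlt : (Finset.univ.filter fun v => WinD G w c v).card <
        (Finset.univ.filter fun v => WinD G w (step G w c) v).card := by
      apply Finset.card_lt_card
      refine Finset.ssubset_iff_subset_ne.2 ⟨hsub, fun heq => ?_⟩
      have : v ∈ (Finset.univ.filter fun v => WinD G w c v) := by
        rw [heq]; simpa using hv
      simp only [Finset.mem_filter, Finset.mem_univ, true_and] at this
      have := this.1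
      rw [hc] at this; cases this
    have hle : (Finset.univ.filter fun v => c v = Strategy.C).card ≤ Fintype.card V :=
      Finset.card_le_univ _
    unfold pot
    nlinarith
  · push Not at hflip
    have h1 := Finset.card_le_card hsub
    have h2 : (Finset.univ.filter fun v => c v = Strategy.C).card <
        (Finset.univ.filter fun v => step G w c v = Strategy.C).card := by
      have hstay : ∀ v, c v = Strategy.C → step G w c v = Strategy.C := by
        intro v hv
        have := hflip v hv
        cases hs : step G w c v
        · rfl
        · exact absurd hs this
      apply Finset.card_lt_card
      refine Finset.ssubset_iff_subset_ne.2 ⟨?_, fun heq => hne ?_⟩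
      · intro v hv
        simp only [Finset.mem_filter, Finset.mem_univ, true_and] at *
        exact hstay v hv
      · funext v
        have := Finset.ext_iff.1 heq v
        simp only [Finset.mem_filter, Finset.mem_univ, true_and] at this
        cases hs : step G w c v <;> cases hv : c v <;> simp_all
    unfold pot
    have := Nat.mul_le_mul_right (Fintype.card V + 1) h1
    omega

lemma stable_of (G : SimpleGraph V) (w : ℝ) (hw : 1 / 2 ≤ w) (c0 : V → Strategy)
    (h4 : ∀ v, (closedNbhd G v).card ≤ 4)
    (hreg : ∀ u v, 3 ≤ (closedNbhd G u).card →
      (closedNbhd G v).card ≤ (closedNbhd G u).card) : EventuallyStable G w c0 := by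
  by_contra hcon
  unfold EventuallyStable at hcon
  push Not at hcon
  have hi : ∀ i, i ≤ pot G w (configSeq G w c0 i) := by
    intro i
    induction i with
    | zero => exact Nat.zero_le _
    | succ k ih =>
      exact Nat.succ_le_of_lt (lt_of_le_of_lt ih (pot_lt G w hw _ h4 hreg (hcon k)))
  have h1 := hi (Fintype.card V * (Fintype.card V + 1) + Fintype.card V + 1)
  have h2 := pot_le G w
    (configSeq G w c0 (Fintype.card V * (Fintype.card V + 1) + Fintype.card V + 1))
  omega

lemma stable_of_three (G : SimpleGraph V) (w : ℝ) (hw : 1 / 2 ≤ w) (c0 : V → Strategy)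
    (h3 : ∀ v, (closedNbhd G v).card ≤ 3) : EventuallyStable G w c0 :=
  stable_of G w hw c0 (fun v => (h3 v).trans (by norm_num)) fun _ v h => (h3 v).trans h

lemma card_iso {W : Type} [Fintype W] {G : SimpleGraph V} {H : SimpleGraph W} (f : G ≃g H)
    (v : V) : (closedNbhd G v).card = (closedNbhd H (f v)).card := by
  apply Finset.card_bij (fun u _ => f u)
  · intro a ha
    rw [mem_closedNbhd] at *
    rcases ha with rfl | ha
    · exact Or.inl rfl
    · exact Or.inr (f.map_adj_iff.2 ha)
  · intro a _ b _ hab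
    exact f.injective hab
  · intro b hb
    refine ⟨f.symm b, ?_, by simp⟩
    rw [mem_closedNbhd] at *
    rcases hb with rfl | hb
    · simp
    · right
      rw [← f.map_adj_iff]
      simpa using hb

end helpers

/-- If `G` is a cycle, a path, or a `3`-regular finite simple graph,
then for every win condition `w ∈ [1/2, 1)` and every initial configuration the
`w`-power index process is eventually stable. -/
theorem statement6 {V : Type} [Fintype V] (G : SimpleGraph V)
    (hG : (∃ n : ℕ, 3 ≤ n ∧ Nonempty (G ≃g SimpleGraph.cycleGraph n)) ∨
          (∃ n : ℕ, Nonempty (G ≃g SimpleGraph.pathGraph n)) ∨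
          (∀ v : V, (closedNbhd G v).card = 4))
    (w : ℝ) (hw1 : 1 / 2 ≤ w) (hw2 : w < 1) (c0 : V → Strategy) :
    EventuallyStable G w c0 := by
  rcases hG with ⟨n, hn, ⟨f⟩⟩ | ⟨n, ⟨f⟩⟩ | h
  · refine stable_of_three G w hw1 c0 fun v => ?_
    rw [card_iso f]
    obtain ⟨m, rfl⟩ : ∃ m, n = m + 1 := ⟨n - 1, by omega⟩
    generalize f v = x
    refine (Finset.card_le_card (t := {x, x + 1, x - 1}) ?_).trans Finset.card_le_three
    intro y hy
    rw [mem_closedNbhd] at hy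
    simp only [Finset.mem_insert, Finset.mem_singleton]
    rcases hy with hy | hy
    · exact Or.inl hy
    · obtain ⟨k, rfl⟩ : ∃ k, m = k + 1 := ⟨m - 1, by omega⟩
      rw [SimpleGraph.cycleGraph_adj] at hy
      rcases hy with hy | hy
      · right; left; rw [← hy]; abel
      · right; right; rw [← hy]; abel
  · refine stable_of_three G w hw1 c0 fun v => ?_
    rw [card_iso f]
    generalize f v = x
    have : (closedNbhd (SimpleGraph.pathGraph n) x).card ≤
        ({x.val, x.val + 1, x.val - 1} : Finset ℕ).card := by
      apply Finset.card_le_card_of_injOn (fun y : Fin n => y.val)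
      · intro y hy
        simp only [Finset.mem_coe, mem_closedNbhd, SimpleGraph.pathGraph_adj] at hy
        simp only [Finset.coe_insert, Finset.coe_singleton, Set.mem_insert_iff,
          Set.mem_singleton_iff]
        rcases hy with rfl | hy | hy <;> omega
      · intro a _ b _ hab
        exact Fin.ext hab
    exact this.trans Finset.card_le_three
  · exact stable_of G w hw1 c0 (fun v => (h v).le) fun u v _ => by rw [h u, h v]
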